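/- Let k be an algebraically closed field of characteristic zero. Then the Jordan plane k⟨x,y⟩/(xy−yx+x²) is not Morita equivalent to k⟨x,y⟩/(xy−yx+x²−1). -/

import Mathlib

universe u

/-- The free associative algebra `k⟨x,y⟩` on two generators. -/
abbrev FA (k : Type u) [Field k] : Type u := FreeAlgebra k (Fin 2)

/-- The quotient of the free algebra `k⟨x,y⟩` by the two-sided ideal generated by `f`. -/
abbrev AQuot (k : Type u) [Field k] (f : FA k) : Type u :=
  RingQuot (fun a b : FA k => a = f ∧ b = 0)

/-- Two rings are Morita equivalent if their module categories are equivalent. -/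
def IsMorita (A B : Type u) [Ring A] [Ring B] : Prop :=
  Nonempty (ModuleCat.{u} A ≌ ModuleCat.{u} B)

section JordanRelation

open Polynomial

variable {k R : Type*} [Field k] [Ring R] [Algebra k R] {x y : R}

/-- The element `∑ fⱼ(x) yʲ` attached to the bivariate polynomial `∑ fⱼ(X) Yʲ`. -/
noncomputable def normalForm (x y : R) (F : k[X][X]) : R :=
  F.sum fun j f => aeval x f * y ^ j

lemma normalForm_add (F G : k[X][X]) :
    normalForm x y (F + G) = normalForm x y F + normalForm x y G :=
  sum_add_index _ _ _ (by simp) (by simp [add_mul])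

lemma normalForm_monomial (j : ℕ) (f : k[X]) :
    normalForm x y (monomial j f) = aeval x f * y ^ j :=
  sum_monomial_index _ _ (by simp)

lemma mul_aeval_of_jordan (h : y * x = x * y + x ^ 2) (f : k[X]) :
    y * aeval x f = aeval x f * y + x ^ 2 * aeval x (derivative f) := by
  induction f using Polynomial.induction_on' with
  | add p q hp hq => simp only [map_add, mul_add, add_mul, hp, hq]; abel
  | monomial n a =>
    have key : ∀ n : ℕ, y * x ^ n = x ^ n * y + n • (x ^ 2 * x ^ (n - 1)) := by
      intro n
      induction n with
      | zero => simp
      | succ n ih =>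
        rcases n with _ | n
        · simpa using h
        · rw [pow_succ, ← mul_assoc, ih, add_mul, mul_assoc, h, smul_mul_assoc,
            Nat.add_sub_cancel, Nat.add_sub_cancel, mul_assoc (x ^ 2), ← pow_succ, mul_add,
            ← mul_assoc, ← pow_add, add_comm (n + 1) 2, pow_add x 2, add_smul (n + 1) 1, one_smul]
          abel
    simp only [aeval_monomial, derivative_monomial, map_mul, map_natCast]
    rw [← mul_assoc, ← Algebra.commutes, mul_assoc, key]
    simp only [nsmul_eq_mul, mul_add, mul_assoc]
    rw [← mul_assoc (x ^ 2) (algebraMap k R a), ← Algebra.commutes a (x ^ 2)]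
    simp only [mul_assoc]
    rw [← mul_assoc (n : R), (Nat.cast_commute n (x ^ 2)).eq, mul_assoc]

lemma exists_normalForm (h : y * x = x * y + x ^ 2)
    (hgen : Algebra.adjoin k {x, y} = ⊤) (r : R) : ∃ F : k[X][X], normalForm x y F = r := by
  suffices H : ∀ F : k[X][X], ∃ G : k[X][X], normalForm x y G = r * normalForm x y F by
    obtain ⟨G, hG⟩ := H (monomial 0 1)
    exact ⟨G, by simpa only [normalForm_monomial, map_one, pow_zero, mul_one] using hG⟩
  have hr : r ∈ Algebra.adjoin k {x, y} := hgen ▸ Algebra.mem_top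
  induction hr using Algebra.adjoin_induction with
  | mem z hz =>
    intro F
    induction F using Polynomial.induction_on' with
    | add F₁ F₂ h₁ h₂ =>
      obtain ⟨G₁, h₁⟩ := h₁
      obtain ⟨G₂, h₂⟩ := h₂
      exact ⟨G₁ + G₂, by rw [normalForm_add, normalForm_add, h₁, h₂, mul_add]⟩
    | monomial j f =>
      rcases hz with rfl | rfl
      · exact ⟨monomial j (X * f), by simp [normalForm_monomial, mul_assoc]⟩
      · refine ⟨monomial (j + 1) f + monomial j (X ^ 2 * derivative f), ?_⟩
        rw [normalForm_add, normalForm_monomial, normalForm_monomial, normalForm_monomial,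
          ← mul_assoc, mul_aeval_of_jordan h, add_mul, pow_succ', mul_assoc]
        simp
  | algebraMap a =>
    intro F
    induction F using Polynomial.induction_on' with
    | add F₁ F₂ h₁ h₂ =>
      obtain ⟨G₁, h₁⟩ := h₁
      obtain ⟨G₂, h₂⟩ := h₂
      exact ⟨G₁ + G₂, by rw [normalForm_add, normalForm_add, h₁, h₂, mul_add]⟩
    | monomial j f => exact ⟨monomial j (C a * f), by simp [normalForm_monomial, mul_assoc]⟩
  | add r s _ _ hr hs =>
    intro F
    obtain ⟨G₁, h₁⟩ := hr F
    obtain ⟨G₂, h₂⟩ := hs F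
    exact ⟨G₁ + G₂, by rw [normalForm_add, h₁, h₂, add_mul]⟩
  | mul r s _ _ hr hs =>
    intro F
    obtain ⟨G₁, h₁⟩ := hs F
    obtain ⟨G₂, h₂⟩ := hr G₁
    exact ⟨G₂, by rw [h₂, h₁, mul_assoc]⟩

/-- The inner derivation `r ↦ r * x - x * r`. -/
def adRight (x : R) : AddMonoid.End R := AddMonoidHom.mulRight x - AddMonoidHom.mulLeft x

lemma adRight_apply (x r : R) : adRight x r = r * x - x * r := rfl

lemma iterate_adRight_mul_of_commute {c : R} (hc : Commute x c) (n : ℕ) (r : R) :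
    (adRight x)^[n] (c * r) = c * (adRight x)^[n] r := by
  induction n generalizing r with
  | zero => rfl
  | succ n ih =>
    rw [Function.iterate_succ_apply, Function.iterate_succ_apply, ← ih]
    congr 1
    simp only [adRight_apply, mul_sub, ← mul_assoc, hc.eq]

lemma iterate_adRight_mul_left (h : y * x = x * y + x ^ 2) (n : ℕ) (r : R) :
    (adRight x)^[n + 1] (y * r) =
      y * (adRight x)^[n + 1] r + (n + 1) • (x ^ 2 * (adRight x)^[n] r) := by
  induction n with
  | zero =>
    simp only [zero_add, Function.iterate_one, Function.iterate_zero, id, adRight_apply, one_smul,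
      mul_sub, ← mul_assoc, h, add_mul]
    abel
  | succ n ih =>
    have hx : adRight x (x ^ 2 * (adRight x)^[n] r) = x ^ 2 * (adRight x)^[n + 1] r := by
      rw [Function.iterate_succ_apply']
      exact iterate_adRight_mul_of_commute ((Commute.refl x).pow_right 2) 1 _
    have hy (s : R) : adRight x (y * s) = y * adRight x s + x ^ 2 * s := by
      simp only [adRight_apply, mul_sub, ← mul_assoc, h, add_mul]
      abel
    rw [Function.iterate_succ_apply', ih, map_add, map_nsmul, hx, hy,
      ← Function.iterate_succ_apply' (adRight x) (n + 1), add_smul (n + 1) 1, one_smul]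
    abel

lemma iterate_adRight_pow_of_lt (h : y * x = x * y + x ^ 2) {j n : ℕ} (hj : j < n) :
    (adRight x)^[n] (y ^ j) = 0 := by
  induction j generalizing n with
  | zero =>
    obtain ⟨n, rfl⟩ := Nat.exists_eq_succ_of_ne_zero hj.ne'
    rw [Function.iterate_succ_apply, adRight_apply]
    simp
  | succ j ih =>
    obtain ⟨n, rfl⟩ := Nat.exists_eq_succ_of_ne_zero (by lia : n ≠ 0)
    rw [pow_succ', Nat.succ_eq_add_one, iterate_adRight_mul_left h, ih (by lia), ih (by lia)]
    simp

lemma iterate_adRight_pow_self (h : y * x = x * y + x ^ 2) (n : ℕ) :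
    (adRight x)^[n] (y ^ n) = n.factorial • x ^ (2 * n) := by
  induction n with
  | zero => simp
  | succ n ih =>
    rw [pow_succ', iterate_adRight_mul_left h, ih, iterate_adRight_pow_of_lt h (by lia),
      Nat.factorial_succ, mul_smul, mul_smul_comm, ← pow_add, show 2 * (n + 1) = 2 + 2 * n by ring]
    simp

lemma iterate_adRight_normalForm (h : y * x = x * y + x ^ 2) (F : k[X][X]) :
    (adRight x)^[F.natDegree] (normalForm x y F) =
      aeval x ((F.natDegree.factorial : k[X]) * F.leadingCoeff * X ^ (2 * F.natDegree)) := by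
  have hc (f : k[X]) : Commute x (aeval x f) := by
    simpa using (Commute.all X f).map (aeval (R := k) x)
  rw [normalForm, sum_over_range _ (by simp), Finset.sum_range_succ, ← AddMonoid.End.coe_pow,
    map_add, map_sum, AddMonoid.End.coe_pow, Finset.sum_eq_zero, zero_add,
    iterate_adRight_mul_of_commute (hc _), iterate_adRight_pow_self h]
  · simp [nsmul_eq_mul, (Nat.cast_commute _ _).eq, mul_assoc]
  · intro j hj
    rw [iterate_adRight_mul_of_commute (hc _),
      iterate_adRight_pow_of_lt h (Finset.mem_range.mp hj), mul_zero]

section Modules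

variable {M : Type*} [AddCommGroup M] [Module R M]

lemma exists_linearMap_of_commute_generators (hgen : Algebra.adjoin k {x, y} = ⊤) (g : M →+ M)
    (hk : ∀ (c : k) m, g (algebraMap k R c • m) = algebraMap k R c • g m)
    (hx : ∀ m, g (x • m) = x • g m) (hy : ∀ m, g (y • m) = y • g m) :
    ∃ G : M →ₗ[R] M, ∀ m, G m = g m := by
  refine ⟨{ g with map_smul' := fun r => ?_ }, fun _ => rfl⟩
  have hr : r ∈ Algebra.adjoin k {x, y} := hgen ▸ Algebra.mem_top
  change ∀ m, g (r • m) = r • g m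
  induction hr using Algebra.adjoin_induction with
  | mem z hz => rcases hz with rfl | rfl <;> assumption
  | algebraMap c => exact hk c
  | add r s _ _ hr hs => simp [add_smul, hr, hs]
  | mul r s _ _ hr hs => simp [mul_smul, hr, hs]

lemma exists_submodule_of_stable (hgen : Algebra.adjoin k {x, y} = ⊤) (K : AddSubgroup M)
    (hk : ∀ (c : k), ∀ m ∈ K, algebraMap k R c • m ∈ K)
    (hx : ∀ m ∈ K, x • m ∈ K) (hy : ∀ m ∈ K, y • m ∈ K) :
    ∃ N : Submodule R M, ∀ m, m ∈ N ↔ m ∈ K := by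
  refine ⟨{ K with smul_mem' := fun r => ?_ }, fun _ => Iff.rfl⟩
  have hr : r ∈ Algebra.adjoin k {x, y} := hgen ▸ Algebra.mem_top
  change ∀ {m}, m ∈ K → r • m ∈ K
  induction hr using Algebra.adjoin_induction with
  | mem z hz => rcases hz with rfl | rfl <;> exact @fun m => by solve_by_elim
  | algebraMap c => exact @hk c
  | add r s _ _ hr hs => exact fun {m} h => add_smul r s m ▸ add_mem (hr h) (hs h)
  | mul r s _ _ hr hs => exact fun {m} h => mul_smul r s m ▸ hr (hs h)

lemma exists_polynomial_annihilating [CharZero k] (h : y * x = x * y + x ^ 2)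
    (hgen : Algebra.adjoin k {x, y} = ⊤) {a : R} (ha : a ≠ 0) (hM : ∀ m : M, a • m = 0) :
    ∃ f : k[X], f ≠ 0 ∧ ∀ m : M, aeval x f • m = 0 := by
  obtain ⟨F, rfl⟩ := exists_normalForm h hgen a
  have hF : F ≠ 0 := by rintro rfl; exact ha (by simp [normalForm])
  refine ⟨_, ?_, fun m => ((congrArg (· • m) (iterate_adRight_normalForm h F)).symm.trans ?_)⟩
  · simp [hF, Nat.factorial_ne_zero]
  · revert m
    induction F.natDegree with
    | zero => exact hM
    | succ n ih =>
      intro m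
      rw [Function.iterate_succ_apply', adRight_apply, sub_smul, mul_smul, mul_smul, ih, ih,
        smul_zero, sub_zero]

lemma smul_eq_zero_of_isSimpleModule [CharZero k] [IsSimpleModule R M]
    (h : y * x = x * y + x ^ 2) (hgen : Algebra.adjoin k {x, y} = ⊤) {a : R} (ha : a ≠ 0)
    (hM : ∀ m : M, a • m = 0) (m : M) : x • m = 0 := by
  obtain ⟨N, hN⟩ := exists_submodule_of_stable (M := M) hgen
    (AddMonoidHom.ker (DistribSMul.toAddMonoidHom M x))
    (fun c m hm => by
      simp only [AddMonoidHom.mem_ker, DistribSMul.toAddMonoidHom_apply] at hm ⊢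
      rw [← mul_smul, ← Algebra.commutes, mul_smul, hm, smul_zero])
    (fun m hm => by
      simp only [AddMonoidHom.mem_ker, DistribSMul.toAddMonoidHom_apply] at hm ⊢
      rw [hm, smul_zero])
    (fun m hm => by
      simp only [AddMonoidHom.mem_ker, DistribSMul.toAddMonoidHom_apply] at hm ⊢
      rw [← mul_smul, eq_sub_of_add_eq h.symm, sub_smul, pow_two, mul_smul, mul_smul, hm,
        smul_zero, smul_zero, sub_zero])
  simp only [AddMonoidHom.mem_ker, DistribSMul.toAddMonoidHom_apply] at hN
  rcases eq_bot_or_eq_top N with rfl | rfl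
  swap
  · exact (hN m).mp trivial
  exfalso
  simp only [Submodule.mem_bot] at hN
  have hinj (m : M) (hm : x • m = 0) : m = 0 := (hN m).mpr hm
  obtain ⟨f, hf, hfM⟩ := exists_polynomial_annihilating h hgen ha hM
  induction hn : f.natDegree using Nat.strong_induction_on generalizing f with
  | _ n ih =>
    by_cases hd : derivative f = 0
    · have := IsSimpleModule.nontrivial R M
      obtain ⟨m, hm⟩ := exists_ne (0 : M)
      have hC := derivative_eq_zero.mp hd
      rw [natDegree_eq_zero] at hC
      obtain ⟨c, rfl⟩ := hC
      have hc : c ≠ 0 := by rintro rfl; simp at hf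
      apply hm
      have := congrArg (algebraMap k R c⁻¹ • ·) (hfM m)
      simpa [← mul_smul, ← map_mul, hc] using this
    · refine ih _ (hn ▸ natDegree_derivative_lt ?_) (derivative f) hd ?_ rfl
      rotate_left
      · exact fun h0 => hd (derivative_of_natDegree_zero h0)
      · intro m
        have := congrArg (· • m) (mul_aeval_of_jordan h f)
        simp only [mul_smul, add_smul, hfM, smul_zero, zero_add, pow_two] at this
        exact hinj _ (hinj _ this.symm)

lemma exists_eigenvector [IsAlgClosed k] [IsSimpleModule R M]
    (hgen : Algebra.adjoin k {x, y} = ⊤) (hx : ∀ m : M, x • m = 0) :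
    ∃ (b : k) (m : M), m ≠ 0 ∧ y • m = algebraMap k R b • m := by
  obtain ⟨p, hp, s, hs, hps⟩ : ∃ p : k[X], p ≠ 0 ∧ ∃ s : M, s ≠ 0 ∧ aeval y p • s = 0 := by
    have := IsSimpleModule.nontrivial R M
    obtain ⟨s, hs⟩ := exists_ne (0 : M)
    by_cases hys : y • s = 0
    · exact ⟨X, X_ne_zero, s, hs, by simpa using hys⟩
    have hcyc (r : R) : ∀ q : k[X], ∃ q' : k[X], r • aeval y (X * q) • s = aeval y (X * q') • s := by
      have hr : r ∈ Algebra.adjoin k {x, y} := hgen ▸ Algebra.mem_top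
      induction hr using Algebra.adjoin_induction with
      | mem z hz =>
        intro q
        rcases hz with rfl | rfl
        · exact ⟨0, by simp [hx]⟩
        · exact ⟨X * q, by simp [mul_smul]⟩
      | algebraMap c => exact fun q =>
        ⟨C c * q, by rw [mul_left_comm X, map_mul _ (C c), aeval_C, mul_smul]⟩
      | add r₁ r₂ _ _ h₁ h₂ =>
        intro q
        obtain ⟨q₁, h₁⟩ := h₁ q
        obtain ⟨q₂, h₂⟩ := h₂ q
        exact ⟨q₁ + q₂, by rw [add_smul, h₁, h₂, mul_add, map_add, add_smul]⟩
      | mul r₁ r₂ _ _ h₁ h₂ =>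
        intro q
        obtain ⟨q₂, h₂⟩ := h₂ q
        obtain ⟨q₁, h₁⟩ := h₁ q₂
        exact ⟨q₁, by rw [mul_smul, h₂, h₁]⟩
    obtain ⟨r, hr⟩ := IsSimpleModule.toSpanSingleton_surjective R hys s
    obtain ⟨q, hq⟩ := hcyc r 1
    refine ⟨X * q - 1, fun h0 => ?_, s, hs, ?_⟩
    · simpa using congrArg (eval 0) h0
    · rw [map_sub, map_one, sub_smul, one_smul, ← hq, sub_eq_zero]
      simpa using hr
  induction hn : p.natDegree using Nat.strong_induction_on generalizing p with
  | _ n ih =>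
    by_cases hd : p.degree = 0
    · exfalso
      rw [eq_C_of_degree_eq_zero hd, aeval_C] at hps
      have hc : p.coeff 0 ≠ 0 := coeff_ne_zero_of_eq_degree hd
      have := congrArg (algebraMap k R (p.coeff 0)⁻¹ • ·) hps
      exact hs (by simpa [← mul_smul, ← map_mul, hc] using this)
    obtain ⟨b, hb⟩ := IsAlgClosed.exists_root p hd
    obtain ⟨q, rfl⟩ := dvd_iff_isRoot.mpr hb
    have hq : q ≠ 0 := right_ne_zero_of_mul hp
    by_cases hqs : aeval y q • s = 0
    · refine ih _ ?_ q hq hqs rfl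
      rw [← hn, natDegree_mul (X_sub_C_ne_zero b) hq, natDegree_X_sub_C]
      lia
    · refine ⟨b, _, hqs, ?_⟩
      rw [map_mul, mul_smul] at hps
      simpa [sub_smul, sub_eq_zero] using hps

end Modules

end JordanRelation

/-- The ring `R` has an unfaithful brick of length two: a module which is an extension of two simple
modules, is killed by a nonzero element of `R`, and whose nonzero endomorphisms are injective. -/
def HasUnfaithfulBrickOfLengthTwo (R : Type u) [Ring R] : Prop :=
  ∃ (M : Type u) (_ : AddCommGroup M) (_ : Module R M) (S : Submodule R M),
    IsSimpleModule R S ∧ IsSimpleModule R (M ⧸ S) ∧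
    (∀ g : M →ₗ[R] M, g = 0 ∨ Function.Injective g) ∧ ∃ a : R, a ≠ 0 ∧ ∀ m : M, a • m = 0

theorem not_hasUnfaithfulBrickOfLengthTwo_of_jordan {k : Type*} {R : Type u} [Field k]
    [IsAlgClosed k] [CharZero k] [Ring R] [Algebra k R] {x y : R} (h : y * x = x * y + x ^ 2)
    (hgen : Algebra.adjoin k {x, y} = ⊤) : ¬ HasUnfaithfulBrickOfLengthTwo R := by
  rintro ⟨M, _, _, S, hS, hT, hbrick, a, ha, haM⟩
  have hxS (s : M) (hs : s ∈ S) : x • s = 0 := congrArg Subtype.val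
    (smul_eq_zero_of_isSimpleModule h hgen ha (fun t : S => Subtype.ext (haM t)) ⟨s, hs⟩)
  have hxT (m : M) : x • m ∈ S := by
    rw [← Submodule.Quotient.mk_eq_zero, Submodule.Quotient.mk_smul]
    refine smul_eq_zero_of_isSimpleModule h hgen ha (fun t => ?_) _
    obtain ⟨t, rfl⟩ := Submodule.Quotient.mk_surjective _ t
    rw [← Submodule.Quotient.mk_smul, haM, Submodule.Quotient.mk_zero]
  obtain ⟨b, ⟨s, hsS⟩, hs, hys⟩ := exists_eigenvector hgen
    (fun t : S => Subtype.ext (hxS t t.2))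
  replace hs : s ≠ 0 := fun h0 => hs (Subtype.ext h0)
  replace hys : y • s = algebraMap k R b • s := congrArg Subtype.val hys
  have hyx (m : M) : y • x • m = x • y • m := by
    rw [← mul_smul, h, add_smul, mul_smul, pow_two, mul_smul, hxS _ (hxT m), add_zero]
  have hcomm (c : k) (r : R) (m : M) : r • algebraMap k R c • m = algebraMap k R c • r • m := by
    rw [← mul_smul, ← Algebra.commutes, mul_smul]
  have hx (m : M) : x • m = 0 := by
    obtain ⟨G, hG⟩ := exists_linearMap_of_commute_generators hgen
      (DistribSMul.toAddMonoidHom M x) (fun c m => hcomm c x m) (fun _ => rfl)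
      (fun m => (hyx m).symm)
    rcases hbrick G with h0 | hinj
    · exact (hG m).symm.trans (by rw [h0, LinearMap.zero_apply])
    · exact absurd (hinj ((hG s).trans ((hxS s hsS).trans (map_zero G).symm))) hs
  have hy (m : M) : y • m = algebraMap k R b • m := by
    obtain ⟨G, hG⟩ := exists_linearMap_of_commute_generators hgen
      (DistribSMul.toAddMonoidHom M (y - algebraMap k R b))
      (fun c m => hcomm c _ m) (fun m => by simp [hx]) (fun m => by
        simp [sub_smul, smul_sub, hcomm])
    have hG' (m : M) : G m = y • m - algebraMap k R b • m := (hG m).trans (sub_smul _ _ _)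
    rcases hbrick G with h0 | hinj
    · rw [← sub_eq_zero, ← hG', h0, LinearMap.zero_apply]
    · exact absurd (hinj ((hG' s).trans (by rw [hys, sub_self, map_zero]))) hs
  let _ : Module k M := Module.compHom M (algebraMap k R)
  have hsmul (c : k) (m : M) : c • m = algebraMap k R c • m := rfl
  obtain ⟨f, hf⟩ : ∃ f : Module.Dual k M, f s ≠ 0 := by
    by_contra! hf
    exact hs ((Module.forall_dual_apply_eq_zero_iff k s).mp hf)
  obtain ⟨G, hG⟩ := exists_linearMap_of_commute_generators hgen
    (f.smulRight s : M →ₗ[k] M).toAddMonoidHom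
    (fun c m => (f.smulRight s).map_smul c m) (fun m => by rw [hx, hx, map_zero])
    (fun m => by rw [hy, hy]; exact (f.smulRight s).map_smul b m)
  replace hG (m : M) : G m = f m • s := hG m
  have hinj : Function.Injective G := by
    refine (hbrick G).resolve_left fun h0 => smul_ne_zero hf hs ?_
    rw [← hG, h0, LinearMap.zero_apply]
  have hT' := IsSimpleModule.nontrivial R (M ⧸ S)
  refine (Submodule.Quotient.nontrivial_iff.mp hT') (eq_top_iff.mpr fun m _ => ?_)
  have hm : m = algebraMap k R (f m * (f s)⁻¹) • s := by
    apply hinj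
    rw [hG, map_smul, hG, ← hsmul, smul_smul, inv_mul_cancel_right₀ hf]
  rw [hm]
  exact S.smul_mem _ hsS

section Quotient

variable {k : Type u} [Field k] {f : FA k}

/-- The image of a generator of the free algebra in `AQuot k f`. -/
noncomputable def AQuot.gen (f : FA k) (i : Fin 2) : AQuot k f :=
  RingQuot.mkAlgHom k (fun a b : FA k => a = f ∧ b = 0) (FreeAlgebra.ι k i)

lemma AQuot.mkAlgHom_self : RingQuot.mkAlgHom k (fun a b : FA k => a = f ∧ b = 0) f = 0 := by
  rw [RingQuot.mkAlgHom_rel k ⟨rfl, rfl⟩, map_zero]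

lemma AQuot.adjoin_gen : Algebra.adjoin k {gen f 0, gen f 1} = ⊤ := by
  have hrange : ({gen f 0, gen f 1} : Set (AQuot k f)) =
      RingQuot.mkAlgHom k (fun a b : FA k => a = f ∧ b = 0) '' Set.range (FreeAlgebra.ι k) := by
    rw [← Set.range_comp]
    ext r
    simp [Fin.exists_fin_two, gen, eq_comm]
  rw [hrange, ← AlgHom.map_adjoin, FreeAlgebra.adjoin_range_ι, Algebra.map_top,
    AlgHom.range_eq_top]
  exact RingQuot.mkAlgHom_surjective k _

lemma AQuot.exists_algHom {A : Type*} [Ring A] [Algebra k A] (g : Fin 2 → A)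
    (hg : FreeAlgebra.lift k g f = 0) :
    ∃ ρ : AQuot k f →ₐ[k] A, ∀ i, ρ (gen f i) = g i := by
  refine ⟨RingQuot.liftAlgHom k ⟨FreeAlgebra.lift k g, ?_⟩, fun i => ?_⟩
  · rintro _ _ ⟨rfl, rfl⟩
    rw [hg, map_zero]
  · rw [gen, RingQuot.liftAlgHom_mkAlgHom_apply, FreeAlgebra.lift_ι_apply]

end Quotient

theorem hasUnfaithfulBrickOfLengthTwo_aQuot_sub_one (k : Type u) [Field k] [CharZero k] :
    HasUnfaithfulBrickOfLengthTwo
      (AQuot k (FreeAlgebra.ι k (0 : Fin 2) * FreeAlgebra.ι k (1 : Fin 2) -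
        FreeAlgebra.ι k (1 : Fin 2) * FreeAlgebra.ι k (0 : Fin 2) +
        FreeAlgebra.ι k (0 : Fin 2) ^ 2 - 1)) := by
  set f : FA k := FreeAlgebra.ι k (0 : Fin 2) * FreeAlgebra.ι k (1 : Fin 2) -
        FreeAlgebra.ι k (1 : Fin 2) * FreeAlgebra.ι k (0 : Fin 2) +
        FreeAlgebra.ι k (0 : Fin 2) ^ 2 - 1 with hf
  have hgen := AQuot.adjoin_gen (f := f)
  let X : Module.End k (k × k) :=
    (LinearMap.fst k k k + LinearMap.snd k k k).prod (LinearMap.snd k k k)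
  let Y : Module.End k (k × k) := (LinearMap.fst k k k).prod (-LinearMap.snd k k k)
  obtain ⟨ρ, hρ⟩ := AQuot.exists_algHom (f := f) ![X, Y] (by
    refine LinearMap.ext fun m => ?_
    ext <;> simp [hf, X, Y, pow_two])
  obtain ⟨χ, hχ⟩ := AQuot.exists_algHom (f := f) ![(-1 : k), 0] (by simp [hf])
  set x := AQuot.gen f 0
  set y := AQuot.gen f 1
  let _ : Module (AQuot k f) (k × k) := Module.compHom (k × k) ρ.toRingHom
  have hsmul (r : AQuot k f) (m : k × k) : r • m = ρ r m := rfl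
  have hx (m : k × k) : x • m = (m.1 + m.2, m.2) := by rw [hsmul, hρ 0]; rfl
  have hy (m : k × k) : y • m = (m.1, -m.2) := by rw [hsmul, hρ 1]; rfl
  have hk (c : k) (m : k × k) : algebraMap k (AQuot k f) c • m = (c * m.1, c * m.2) := by
    rw [hsmul, AlgHom.commutes]; rfl
  obtain ⟨S, hS⟩ := exists_submodule_of_stable hgen (AddMonoidHom.ker (AddMonoidHom.snd k k))
    (fun c m (hm : m.2 = 0) => show _ = _ by simp [hk, hm])
    (fun m (hm : m.2 = 0) => show _ = _ by simp [x, hx, hm])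
    (fun m (hm : m.2 = 0) => show _ = _ by simp [hy, hm])
  replace hS (m : k × k) : m ∈ S ↔ m.2 = 0 := hS m
  refine ⟨k × k, _, _, S, ?_, ?_, fun g => ?_, (x - 1) * (x - 1), fun h0 => ?_, fun m => ?_⟩
  · rw [isSimpleModule_iff_toSpanSingleton_surjective]
    refine ⟨⟨⟨(1, 0), (hS _).mpr rfl⟩, 0, fun h0 => ?_⟩, ?_⟩
    · simpa using congrArg (fun t : S => t.1.1) h0
    · rintro ⟨m, hm⟩ hm0 ⟨n, hn⟩
      rw [hS] at hm hn
      have hm1 : m.1 ≠ 0 := fun h1 => hm0 (Subtype.ext (Prod.ext h1 hm))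
      refine ⟨algebraMap k _ (n.1 * m.1⁻¹), Subtype.ext ?_⟩
      change algebraMap k (AQuot k f) _ • m = n
      rw [hk]
      ext <;> simp [hm, hn, hm1]
  · rw [isSimpleModule_iff_toSpanSingleton_surjective]
    refine ⟨⟨Submodule.Quotient.mk (0, 1), 0, fun h0 => ?_⟩, ?_⟩
    · rw [Submodule.Quotient.mk_eq_zero, hS] at h0
      exact one_ne_zero h0
    · intro m hm n
      obtain ⟨m, rfl⟩ := Submodule.Quotient.mk_surjective _ m
      obtain ⟨n, rfl⟩ := Submodule.Quotient.mk_surjective _ n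
      rw [Ne, Submodule.Quotient.mk_eq_zero, hS] at hm
      refine ⟨algebraMap k _ (n.2 * m.2⁻¹), ?_⟩
      rw [LinearMap.toSpanSingleton_apply, ← Submodule.Quotient.mk_smul, Submodule.Quotient.eq,
        hS, hk]
      simp [hm]
  · have h2 (c : k) (hc : -c = c) : c = 0 := CharZero.eq_neg_self_iff.mp hc.symm
    have h₁ : (g (1, 0)).2 = 0 := by
      have := g.map_smul y (1, 0)
      rw [hy, hy, neg_zero] at this
      exact h2 _ (congrArg Prod.snd this).symm
    have h₂ : (g (0, 1)).1 = 0 := by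
      have := g.map_smul y (0, 1)
      rw [hy, hy, show ((0, 1).1, -(0, 1).2) = -((0, 1) : k × k) by simp, map_neg] at this
      exact h2 _ (congrArg Prod.fst this)
    have h₃ : (g (1, 0)).1 = (g (0, 1)).2 := by
      have := g.map_smul x (0, 1)
      rw [hx, hx, show ((0, 1).1 + (0, 1).2, (0, 1).2) = ((1, 0) + (0, 1) : k × k) by simp,
        map_add] at this
      simpa [h₂] using congrArg Prod.fst this
    have hg (m : k × k) : g m = ((g (0, 1)).2 * m.1, (g (0, 1)).2 * m.2) := by
      conv_lhs => rw [show m = algebraMap k (AQuot k f) m.1 • (1, 0) +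
        algebraMap k (AQuot k f) m.2 • (0, 1) by rw [hk, hk]; simp]
      rw [map_add, map_smul, map_smul, hk, hk, h₁, h₂, h₃]
      ext <;> simp [mul_comm]
    by_cases hc : (g (0, 1)).2 = 0
    · left
      ext m <;> simp [hg m, hc]
    · right
      intro m n hmn
      rw [hg m, hg n] at hmn
      simpa [hc, Prod.ext_iff] using hmn
  · have := congrArg χ h0
    rw [map_mul, map_sub, map_one, map_zero, hχ 0] at this
    norm_num at this
  · rw [mul_smul, sub_smul, sub_smul, one_smul, one_smul, hx, hx]
    ext <;> simp

section Transport

open CategoryTheory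

lemma simple_map_equivalence {C D : Type*} [Category* C] [Category* D]
    [Limits.HasZeroMorphisms C] [Limits.HasZeroMorphisms D] (e : C ≌ D) (X : C) [Simple X] :
    Simple (e.functor.obj X) where
  mono_isIso_iff_nonzero {Y} f _ := by
    let η : e.inverse.obj (e.functor.obj X) ⟶ X := e.unitInv.app X
    rw [← isIso_iff_of_reflects_iso f e.inverse, ← isIso_comp_right_iff _ η,
      Simple.mono_isIso_iff_nonzero, ne_eq, ne_eq, not_iff_not,
      ← Limits.zero_comp (f := η), cancel_mono, e.inverse.map_eq_zero_iff]

lemma exists_ne_zero_smul_eq_zero {A : Type u} [Ring A] {P Q M : ModuleCat.{u} A} [Projective Q]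
    (f : P ⟶ Q) (hf : f ≠ 0) (hM : ∀ g : Q ⟶ M, f ≫ g = 0) :
    ∃ a : A, a ≠ 0 ∧ ∀ m : M, a • m = 0 := by
  obtain ⟨p, hp⟩ : ∃ p, f.hom p ≠ 0 := by
    by_contra! h
    exact hf (ModuleCat.hom_ext (LinearMap.ext h))
  have hQ : Module.Projective A Q := inferInstance
  obtain ⟨s, hs⟩ := hQ.out
  obtain ⟨q, hq⟩ : ∃ q, s (f.hom p) q ≠ 0 := by
    by_contra! h
    apply hp
    rw [← hs (f.hom p), show s (f.hom p) = 0 from Finsupp.ext h, map_zero]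
  refine ⟨_, hq, fun m => ?_⟩
  have := hM (ModuleCat.ofHom
    (LinearMap.toSpanSingleton A M m ∘ₗ Finsupp.lapply (R := A) q ∘ₗ s))
  exact LinearMap.congr_fun (ModuleCat.hom_ext_iff.mp this) p

theorem HasUnfaithfulBrickOfLengthTwo.of_equivalence {A B : Type u} [Ring A] [Ring B]
    (e : ModuleCat.{u} A ≌ ModuleCat.{u} B) (h : HasUnfaithfulBrickOfLengthTwo A) :
    HasUnfaithfulBrickOfLengthTwo B := by
  obtain ⟨M, _, _, S, hS, hT, hbrick, a, ha, haM⟩ := h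
  let σ : ShortComplex (ModuleCat.{u} A) :=
    ShortComplex.moduleCatMk S.subtype S.mkQ (by ext; simp)
  have hσ : σ.ShortExact :=
    { exact := by
        rw [ShortComplex.moduleCat_exact_iff_range_eq_ker]
        exact S.range_subtype.trans S.ker_mkQ.symm
      mono_f := (ModuleCat.mono_iff_injective _).mpr S.injective_subtype
      epi_g := (ModuleCat.epi_iff_surjective _).mpr S.mkQ_surjective }
  have hτ : (σ.map e.functor).ShortExact := hσ.map_of_exact e.functor
  have hS' : Simple (σ.map e.functor).X₁ := by
    have : Simple σ.X₁ := simple_iff_isSimpleModule.mpr hS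
    exact simple_map_equivalence e σ.X₁
  have hT' : Simple (σ.map e.functor).X₃ := by
    have : Simple σ.X₃ := simple_iff_isSimpleModule.mpr hT
    exact simple_map_equivalence e σ.X₃
  rw [simple_iff_isSimpleModule'] at hS' hT'
  refine ⟨e.functor.obj σ.X₂, inferInstance, inferInstance,
    LinearMap.range (σ.map e.functor).f.hom, ?_, ?_, fun g => ?_, ?_⟩
  · exact .congr (LinearEquiv.ofInjective _ hτ.moduleCat_injective_f).symm
  · have hker := hτ.exact.moduleCat_range_eq_ker
    exact .congr ((Submodule.quotEquivOfEq _ _ hker).trans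
      (LinearMap.quotKerEquivOfSurjective _ hτ.moduleCat_surjective_g))
  · obtain ⟨g', hg'⟩ := e.functor.map_surjective (ModuleCat.ofHom g)
    rcases hbrick g'.hom with h0 | hinj
    · left
      have h0' : g' = 0 := ModuleCat.hom_ext h0
      rw [h0', Functor.map_zero] at hg'
      exact (ModuleCat.hom_ext_iff.mp hg').symm
    · right
      have : Mono g' := (ModuleCat.mono_iff_injective _).mpr hinj
      have hmono : Mono (ModuleCat.ofHom g) := hg' ▸ inferInstance
      exact (ModuleCat.mono_iff_injective _).mp hmono
  · have hproj : Projective (ModuleCat.of A A) := inferInstance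
    have := (e.map_projective_iff (ModuleCat.of A A)).mpr hproj
    let φ : ModuleCat.of A A ⟶ ModuleCat.of A A :=
      ModuleCat.ofHom (LinearMap.toSpanSingleton A A a)
    refine exists_ne_zero_smul_eq_zero (e.functor.map φ) (fun h0 => ha ?_) (fun g => ?_)
    · rw [e.functor.map_eq_zero_iff] at h0
      simpa [φ] using LinearMap.congr_fun (ModuleCat.hom_ext_iff.mp h0) (1 : A)
    · obtain ⟨g, rfl⟩ := e.functor.map_surjective g
      rw [← e.functor.map_comp, e.functor.map_eq_zero_iff]
      ext
      change g.hom ((1 : A) • a) = 0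
      rw [one_smul, ← mul_one a, ← smul_eq_mul, map_smul]
      exact haM _

end Transport

/-- Over an algebraically closed field of characteristic zero, the Jordan plane
`k⟨x,y⟩/(xy−yx+x²)` is not Morita equivalent to `k⟨x,y⟩/(xy−yx+x²−1)`. -/
theorem statement2 (k : Type u) [Field k] [IsAlgClosed k] [CharZero k] :
    ¬ IsMorita
      (AQuot k (FreeAlgebra.ι k (0 : Fin 2) * FreeAlgebra.ι k (1 : Fin 2) -
        FreeAlgebra.ι k (1 : Fin 2) * FreeAlgebra.ι k (0 : Fin 2) +
        FreeAlgebra.ι k (0 : Fin 2) ^ 2))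
      (AQuot k (FreeAlgebra.ι k (0 : Fin 2) * FreeAlgebra.ι k (1 : Fin 2) -
        FreeAlgebra.ι k (1 : Fin 2) * FreeAlgebra.ι k (0 : Fin 2) +
        FreeAlgebra.ι k (0 : Fin 2) ^ 2 - 1)) := by
  rintro ⟨e⟩
  refine not_hasUnfaithfulBrickOfLengthTwo_of_jordan ?_ (AQuot.adjoin_gen (k := k))
    (HasUnfaithfulBrickOfLengthTwo.of_equivalence e.symm
      (hasUnfaithfulBrickOfLengthTwo_aQuot_sub_one k))
  have h := AQuot.mkAlgHom_self (f := FreeAlgebra.ι k (0 : Fin 2) * FreeAlgebra.ι k (1 : Fin 2) -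
        FreeAlgebra.ι k (1 : Fin 2) * FreeAlgebra.ι k (0 : Fin 2) +
        FreeAlgebra.ι k (0 : Fin 2) ^ 2)
  rw [map_add, map_sub, map_mul, map_mul, map_pow] at h
  exact (sub_eq_zero.mp ((sub_add_eq_add_sub _ _ _).symm.trans h)).symm
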